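/- arXiv:math/0507196 — 2 statements merged into one kernel-verified Lean document; each statement's English description precedes it below -/
import Mathlib

section
/- If t and t' are terms in T_n^{*,∘} with t =_ALD t', then I(t) = I(t'), the sequences J(t) and J(t') have the same length, and for every index k the k-th entries satisfy J(t)_k =_LD J(t')_k. -/
/-- Terms in `n` variables over two binary operation symbols `*` and `∘`. -/
inductive ALDTerm (n : ℕ) : Type
  | var : Fin n → ALDTerm n
  | star : ALDTerm n → ALDTerm n → ALDTerm n
  | circ : ALDTerm n → ALDTerm n → ALDTerm n

/-- The smallest congruence on terms containing all instances of (LD), (ALD₁), (ALD₂). -/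
inductive ALDCong {n : ℕ} : ALDTerm n → ALDTerm n → Prop
  | LD (t₁ t₂ t₃ : ALDTerm n) :
      ALDCong (.star t₁ (.star t₂ t₃)) (.star (.star t₁ t₂) (.star t₁ t₃))
  | ALD1 (t₁ t₂ t₃ : ALDTerm n) :
      ALDCong (.star (.circ t₁ t₂) t₃) (.star t₁ (.star t₂ t₃))
  | ALD2 (t₁ t₂ t₃ : ALDTerm n) :
      ALDCong (.star t₁ (.circ t₂ t₃)) (.circ (.star t₁ t₂) (.star t₁ t₃))
  | refl (t : ALDTerm n) : ALDCong t t
  | symm {s t : ALDTerm n} : ALDCong s t → ALDCong t s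
  | trans {s t u : ALDTerm n} : ALDCong s t → ALDCong t u → ALDCong s u
  | starCong {s s' t t' : ALDTerm n} : ALDCong s s' → ALDCong t t' →
      ALDCong (.star s t) (.star s' t')
  | circCong {s s' t t' : ALDTerm n} : ALDCong s s' → ALDCong t t' →
      ALDCong (.circ s t) (.circ s' t')

/-- Terms in `n` variables over the single operation symbol `*`. -/
inductive STerm (n : ℕ) : Type
  | var : Fin n → STerm n
  | star : STerm n → STerm n → STerm n

/-- The smallest congruence on `*`-terms containing all instances of (LD). -/
inductive LDCong {n : ℕ} : STerm n → STerm n → Prop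
  | LD (t₁ t₂ t₃ : STerm n) :
      LDCong (.star t₁ (.star t₂ t₃)) (.star (.star t₁ t₂) (.star t₁ t₃))
  | refl (t : STerm n) : LDCong t t
  | symm {s t : STerm n} : LDCong s t → LDCong t s
  | trans {s t u : STerm n} : LDCong s t → LDCong t u → LDCong s u
  | starCong {s s' t t' : STerm n} : LDCong s s' → LDCong t t' →
      LDCong (.star s t) (.star s' t')

/-- Terms in a single variable over the single operation symbol `∘`. -/
inductive CTerm : Type
  | var : CTerm
  | circ : CTerm → CTerm → CTerm

/-- The operation `⃗s ⃗* ⃗t`: the sequence of the same length as `⃗t` whose `j`-th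
entry is `s₁*(s₂*(⋯*(s_p*t_j)⋯))`. -/
def vstar {n : ℕ} (s t : List (STerm n)) : List (STerm n) :=
  t.map fun x => s.foldr STerm.star x

/-- The invariant `I(t)`, a `∘`-term in one variable. -/
def ITerm {n : ℕ} : ALDTerm n → CTerm
  | .var _ => .var
  | .star _ t₂ => ITerm t₂
  | .circ t₁ t₂ => .circ (ITerm t₁) (ITerm t₂)

/-- The invariant `J(t)`, a nonempty finite sequence of `*`-terms. -/
def JTerm {n : ℕ} : ALDTerm n → List (STerm n)
  | .var i => [.var i]
  | .star t₁ t₂ => vstar (JTerm t₁) (JTerm t₂)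
  | .circ t₁ t₂ => JTerm t₁ ++ JTerm t₂

/-- Left multiplication by a sequence respects LD-equivalence in its argument. -/
theorem LDCong.foldr_right {n : ℕ} (a : List (STerm n)) {x y : STerm n} (h : LDCong x y) :
    LDCong (a.foldr STerm.star x) (a.foldr STerm.star y) := by
  induction a with
  | nil => exact h
  | cons u a ih => exact .starCong (.refl u) ih

/-- Left multiplication by a sequence respects LD-equivalence in all arguments. -/
theorem LDCong.foldr {n : ℕ} {a b : List (STerm n)} (hab : List.Forall₂ LDCong a b)
    {x y : STerm n} (h : LDCong x y) :
    LDCong (a.foldr STerm.star x) (b.foldr STerm.star y) := by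
  induction hab with
  | nil => exact h
  | cons hu _ ih => exact .starCong hu ih

/-- Left multiplication by a sequence is an endomorphism up to LD-equivalence. -/
theorem LDCong.foldr_star {n : ℕ} (a : List (STerm n)) (x y : STerm n) :
    LDCong (a.foldr STerm.star (.star x y))
      (.star (a.foldr STerm.star x) (a.foldr STerm.star y)) := by
  induction a with
  | nil => exact .refl _
  | cons u a ih => exact .trans (.starCong (.refl u) ih) (.LD ..)

/-- Left distributivity of left multiplication by sequences, up to LD-equivalence. -/
theorem LDCong.foldr_foldr {n : ℕ} (a b : List (STerm n)) (x : STerm n) :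
    LDCong (a.foldr STerm.star (b.foldr STerm.star x))
      ((vstar a b).foldr STerm.star (a.foldr STerm.star x)) := by
  induction b with
  | nil => exact .refl _
  | cons u b ih => exact .trans (foldr_star ..) (.starCong (.refl _) ih)

theorem ITerm_eq_of_ALDCong {n : ℕ} {t t' : ALDTerm n} (h : ALDCong t t') :
    ITerm t = ITerm t' := by
  induction h <;> simp_all [ITerm]

theorem forall₂_LDCong_refl {n : ℕ} (l : List (STerm n)) : List.Forall₂ LDCong l l :=
  List.forall₂_same.2 fun x _ => .refl x

theorem forall₂_LDCong_trans {n : ℕ} {a b c : List (STerm n)} (hab : List.Forall₂ LDCong a b)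
    (hbc : List.Forall₂ LDCong b c) : List.Forall₂ LDCong a c := by
  induction hab generalizing c with
  | nil => exact hbc
  | cons h _ ih =>
    cases hbc with
    | cons h' hbc => exact .cons (.trans h h') (ih hbc)

theorem JTerm_forall₂_of_ALDCong {n : ℕ} {t t' : ALDTerm n} (h : ALDCong t t') :
    List.Forall₂ LDCong (JTerm t) (JTerm t') := by
  induction h with
  | LD t₁ t₂ t₃ =>
    have h_map : List.Forall₂ LDCong
        ((JTerm t₃).map fun x => (JTerm t₁).foldr STerm.star ((JTerm t₂).foldr STerm.star x))
        ((JTerm t₃).map fun x =>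
          (vstar (JTerm t₁) (JTerm t₂)).foldr STerm.star ((JTerm t₁).foldr STerm.star x)) := by
      rw [List.forall₂_map_left_iff, List.forall₂_map_right_iff]
      exact List.forall₂_same.2 fun x _ => .foldr_foldr _ _ x
    simpa only [JTerm, vstar, List.map_map, Function.comp_def] using h_map
  | ALD1 t₁ t₂ t₃ =>
    simp only [JTerm, vstar, List.map_map, Function.comp_def, List.foldr_append]
    exact forall₂_LDCong_refl _
  | ALD2 t₁ t₂ t₃ =>
    simp only [JTerm, vstar, List.map_append]
    exact forall₂_LDCong_refl _
  | refl t => exact forall₂_LDCong_refl _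
  | symm _ ih => exact ih.flip.imp fun _ _ => .symm
  | trans _ _ ih₁ ih₂ => exact forall₂_LDCong_trans ih₁ ih₂
  | starCong _ _ ih₁ ih₂ =>
    simp only [JTerm, vstar, List.forall₂_map_left_iff, List.forall₂_map_right_iff]
    exact ih₂.imp fun _ _ => .foldr ih₁
  | circCong _ _ ih₁ ih₂ => exact List.rel_append ih₁ ih₂

/-- if `t =_ALD t'`, then `I(t) = I(t')`, the sequences `J(t)` and `J(t')`
have the same length, and their entries are pairwise LD-equivalent. -/
theorem I_J_ALD_invariant {n : ℕ} {t t' : ALDTerm n} (h : ALDCong t t') :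
    ITerm t = ITerm t' ∧
    (JTerm t).length = (JTerm t').length ∧
    ∀ (k : ℕ) (hk : k < (JTerm t).length) (hk' : k < (JTerm t').length),
      LDCong ((JTerm t).get ⟨k, hk⟩) ((JTerm t').get ⟨k, hk'⟩) := by
  have hJ := JTerm_forall₂_of_ALDCong h
  exact ⟨ITerm_eq_of_ALDCong h, hJ.length_eq, fun _ hk hk' => hJ.get hk hk'⟩
end

section
/- For every term t in T_n^{*,∘}, one has t =_ALD I(t)[J(t)], where the length of J(t) equals the size (number of variable occurrences) of I(t). -/
/-- The canonical embedding of `*`-terms into `{*,∘}`-terms. -/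
def STerm.toALDTerm {n : ℕ} : STerm n → ALDTerm n
  | .var i => .var i
  | .star a b => .star a.toALDTerm b.toALDTerm

/-- The size of a `∘`-term in one variable: its number of variable occurrences. -/
def CTerm.size : CTerm → ℕ
  | .var => 1
  | .circ a b => a.size + b.size

/-- `Subst v ⃗t t` means `t = v[⃗t]`: `t` is obtained from `v` by substituting the
entries of `⃗t` for the successive variable occurrences of `v` from left to right. -/
inductive Subst {n : ℕ} : CTerm → List (STerm n) → ALDTerm n → Prop
  | var (s : STerm n) : Subst .var [s] s.toALDTerm
  | circ {u v : CTerm} {ss ts : List (STerm n)} {t₁ t₂ : ALDTerm n} :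
      Subst u ss t₁ → Subst v ts t₂ →
      Subst (.circ u v) (ss ++ ts) (.circ t₁ t₂)

theorem ALDCong.star_toALDTerm_foldr {n : ℕ} {u : CTerm} {ss : List (STerm n)} {r : ALDTerm n}
    (h : Subst u ss r) (x : STerm n) :
    ALDCong (.star r x.toALDTerm) (ss.foldr STerm.star x).toALDTerm := by
  induction h generalizing x with
  | var s => exact .refl _
  | circ _ _ ih₁ ih₂ =>
    rw [List.foldr_append]
    exact (ALDCong.ALD1 _ _ _).trans (((ALDCong.refl _).starCong (ih₂ x)).trans (ih₁ _))

theorem Subst.exists_vstar {n : ℕ} {u v : CTerm} {ss ts : List (STerm n)} {r q : ALDTerm n}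
    (hr : Subst u ss r) (hq : Subst v ts q) :
    ∃ p, Subst v (vstar ss ts) p ∧ ALDCong (.star r q) p := by
  induction hq with
  | var s => exact ⟨_, .var _, ALDCong.star_toALDTerm_foldr hr s⟩
  | circ _ _ ih₁ ih₂ =>
    obtain ⟨p₁, hp₁, hc₁⟩ := ih₁
    obtain ⟨p₂, hp₂, hc₂⟩ := ih₂
    refine ⟨.circ p₁ p₂, ?_, (ALDCong.ALD2 _ _ _).trans (hc₁.circCong hc₂)⟩
    rw [vstar, List.map_append]
    exact hp₁.circ hp₂

theorem Subst.length_eq_size {n : ℕ} {v : CTerm} {ts : List (STerm n)} {r : ALDTerm n}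
    (h : Subst v ts r) : ts.length = v.size := by
  induction h with
  | var s => rfl
  | circ _ _ ih₁ ih₂ => rw [List.length_append, ih₁, ih₂, CTerm.size]

theorem exists_subst_ITerm_JTerm {n : ℕ} (t : ALDTerm n) :
    ∃ r : ALDTerm n, Subst (ITerm t) (JTerm t) r ∧ ALDCong t r := by
  induction t with
  | var i => exact ⟨_, .var (.var i), .refl _⟩
  | star t₁ t₂ ih₁ ih₂ =>
    obtain ⟨r₁, hr₁, hc₁⟩ := ih₁
    obtain ⟨r₂, hr₂, hc₂⟩ := ih₂
    obtain ⟨p, hp, hc⟩ := hr₁.exists_vstar hr₂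
    exact ⟨p, hp, (hc₁.starCong hc₂).trans hc⟩
  | circ t₁ t₂ ih₁ ih₂ =>
    obtain ⟨r₁, hr₁, hc₁⟩ := ih₁
    obtain ⟨r₂, hr₂, hc₂⟩ := ih₂
    exact ⟨_, hr₁.circ hr₂, hc₁.circCong hc₂⟩

/-- every term `t` satisfies `t =_ALD I(t)[J(t)]`, where the length of
`J(t)` equals the size of `I(t)`. -/
theorem ALD_equiv_special {n : ℕ} (t : ALDTerm n) :
    (JTerm t).length = (ITerm t).size ∧
    ∃ r : ALDTerm n, Subst (ITerm t) (JTerm t) r ∧ ALDCong t r := by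
  obtain ⟨r, hr, hc⟩ := exists_subst_ITerm_JTerm t
  exact ⟨hr.length_eq_size, r, hr, hc⟩
end
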